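/- Let (Xₙ) be a Markov chain on ℤ₊ and suppose there exists an integer-valued random variable η with Eη > 0 such that P{η > j} ≤ P_i{X₁ − X₀ > j} for all i ∈ ℤ₊ and j ∈ ℤ (η is a stochastic minorant for all jumps). Then there exists γ > 0 such that sup_{i∈ℤ₊} E_i e^{γ ℓ(i)} < ∞, where ℓ(i) = ∑_{n≥0} 1{Xₙ = i}. -/

import Mathlib

open MeasureTheory Filter Topology
open scoped ENNReal NNReal

structure MC where
  μ : ℕ → Measure (ℕ → ℕ)
  prob : ∀ i, IsProbabilityMeasure (μ i)
  start : ∀ i, μ i {ω | ω 0 = i} = 1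
  P : ℕ → ℕ → ℝ≥0∞
  P_sum : ∀ i, ∑' j, P i j = 1
  markov : ∀ i, (μ i).map (fun ω n => ω (n + 1)) = Measure.sum fun j => P i j • μ j

noncomputable def qt (Q : ℕ → ℕ → ℝ≥0∞) (i : ℕ) : ℝ≥0∞ := ∑' j, Q i j

noncomputable def fQ (Q : ℕ → ℕ → ℝ≥0∞) (X : MC) (i : ℕ) : ℝ≥0∞ :=
  ∫⁻ ω, ∏' n, qt Q (ω n) ∂(X.μ i)

def condC (Q : ℕ → ℕ → ℝ≥0∞) (X : MC) : Prop :=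
  ∀ i, (∫⁻ ω, ∏' n, max (qt Q (ω n)) 1 ∂(X.μ i)) < ∞

noncomputable def Qpow (Q : ℕ → ℕ → ℝ≥0∞) : ℕ → ℕ → ℕ → ℝ≥0∞
  | 0 => fun i j => if i = j then 1 else 0
  | n + 1 => fun i j => ∑' k, Q i k * Qpow Q n k j

def Irred (Q : ℕ → ℕ → ℝ≥0∞) : Prop := ∀ i j, ∃ n, 0 < Qpow Q n i j

noncomputable def locTime (j : ℕ) (ω : ℕ → ℕ) : ℝ≥0∞ := ∑' n, if ω n = j then 1 else 0

noncomputable def locExp (γ : ℝ) (j : ℕ) (ω : ℕ → ℕ) : ℝ≥0∞ :=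
  ∏' n, if ω n = j then ENNReal.ofReal (Real.exp γ) else 1

noncomputable def deltaQ (Q : ℕ → ℕ → ℝ≥0∞) (j : ℕ) : ℝ := Real.log (qt Q j).toReal

noncomputable def jumpP (X : MC) (i : ℕ) (j : ℤ) : ℝ≥0∞ :=
  if 0 ≤ (i : ℤ) + j then X.P i ((i : ℤ) + j).toNat else 0

noncomputable def GG (ν : Measure ℤ) : ℕ → ℤ → ℝ≥0∞
  | 0 => fun k => if k ≤ 0 then 1 else 0
  | n + 1 => fun k => if k ≤ 0 then 1 else ∫⁻ y, GG ν n (k + y) ∂ν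

lemma GG_nonpos (ν : Measure ℤ) (n : ℕ) (k : ℤ) (hk : k ≤ 0) : GG ν n k = 1 := by
  cases n <;> simp [GG, hk]

lemma GG_le_one (ν : Measure ℤ) [IsProbabilityMeasure ν] (n : ℕ) : ∀ k, GG ν n k ≤ 1 := by
  induction n with
  | zero => intro k; simp only [GG]; split_ifs <;> simp
  | succ n ih =>
    intro k; simp only [GG]; split_ifs
    · simp
    · calc ∫⁻ y, GG ν n (k + y) ∂ν ≤ ∫⁻ y, 1 ∂ν := lintegral_mono fun y => ih _
        _ = 1 := by simp

lemma GG_anti (ν : Measure ℤ) [IsProbabilityMeasure ν] (n : ℕ) : Antitone (GG ν n) := by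
  induction n with
  | zero =>
    intro a b hab; simp only [GG]; split_ifs <;> first | omega | simp
  | succ n ih =>
    intro a b hab
    by_cases ha : a ≤ 0
    · rw [GG_nonpos ν _ a ha]; exact GG_le_one ν _ _
    · have hb : ¬ b ≤ 0 := by omega
      simp only [GG, ha, hb, if_false]
      exact lintegral_mono fun y => ih (by omega)

lemma GG_mono (ν : Measure ℤ) [IsProbabilityMeasure ν] (n : ℕ) :
    ∀ k, GG ν n k ≤ GG ν (n + 1) k := by
  induction n with
  | zero =>
    intro k
    by_cases hk : k ≤ 0
    · rw [GG_nonpos ν _ k hk, GG_nonpos ν _ k hk]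
    · simp [GG, hk]
  | succ n ih =>
    intro k
    by_cases hk : k ≤ 0
    · rw [GG_nonpos ν _ k hk, GG_nonpos ν _ k hk]
    · rw [GG, GG]
      simp only [hk, if_false]
      exact lintegral_mono fun y => ih _

lemma tsum_shift_aux (g : ℤ → ℝ≥0∞) (hg : ∀ k ≤ 0, g k = 1) (y : ℤ) :
    (∑' k : ℕ, g ((k : ℤ) + 1 + y)) + ∑ k ∈ Finset.range y.toNat, g ((k : ℤ) + 1)
      = (∑' k : ℕ, g ((k : ℤ) + 1)) + ((-y).toNat : ℝ≥0∞) := by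
  rcases le_total 0 y with hy | hy
  · obtain ⟨n, rfl⟩ := Int.eq_ofNat_of_zero_le hy
    have h := Summable.sum_add_tsum_nat_add' (f := fun k : ℕ => g ((k : ℤ) + 1)) (k := n) ENNReal.summable
    simp only [Int.toNat_natCast]
    rw [← h]
    have : (-(n : ℤ)).toNat = 0 := by omega
    rw [this, add_comm]
    simp only [Nat.cast_zero, add_zero]
    congr 1
    refine tsum_congr fun k => ?_
    congr 1; push_cast; ring
  · obtain ⟨n, hn⟩ := Int.eq_ofNat_of_zero_le (neg_nonneg.2 hy)
    have h := Summable.sum_add_tsum_nat_add' (f := fun k : ℕ => g ((k : ℤ) + 1 + y)) (k := n)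
      ENNReal.summable
    have h0 : y.toNat = 0 := by omega
    rw [← h, h0, hn]
    have h1 : ∑ k ∈ Finset.range n, g ((k : ℤ) + 1 + y) = n := by
      rw [Finset.sum_congr rfl (g := fun _ => (1 : ℝ≥0∞))]
      · simp
      · intro k hk
        rw [Finset.mem_range] at hk
        exact hg _ (by omega)
    rw [h1]
    simp only [Finset.range_zero, Finset.sum_empty, add_zero, Int.toNat_natCast]
    rw [add_comm]
    congr 1
    refine tsum_congr fun k => ?_
    congr 1; push_cast; omega

lemma pos_neg_lt (ν : Measure ℤ) [IsProbabilityMeasure ν]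
    (hint : Integrable (fun x : ℤ => (x : ℝ)) ν) (hmean : 0 < ∫ x, (x : ℝ) ∂ν) :
    (∫⁻ y : ℤ, ((-y).toNat : ℝ≥0∞) ∂ν) < ∫⁻ y : ℤ, (y.toNat : ℝ≥0∞) ∂ν := by
  have e : ∀ y : ℤ, ENNReal.ofReal (y : ℝ) = (y.toNat : ℝ≥0∞) := by
    intro y
    rcases le_total 0 y with hy | hy
    · obtain ⟨n, rfl⟩ := Int.eq_ofNat_of_zero_le hy
      simp
    · rw [ENNReal.ofReal_of_nonpos (by exact_mod_cast hy), Int.toNat_of_nonpos hy]; simp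
  have h := integral_eq_lintegral_pos_part_sub_lintegral_neg_part hint
  have e2 : ∀ y : ℤ, ENNReal.ofReal (-(y : ℝ)) = ((-y).toNat : ℝ≥0∞) := by
    intro y; rw [← e]; push_cast; rfl
  simp only [e, e2] at h
  rw [h] at hmean
  have hf1 : (∫⁻ y : ℤ, (y.toNat : ℝ≥0∞) ∂ν) ≠ ∞ := by
    have := hint.lintegral_lt_top
    simp only [e] at this; exact this.ne
  by_contra hcon
  push Not at hcon
  have hf2 : (∫⁻ y : ℤ, ((-y).toNat : ℝ≥0∞) ∂ν) ≠ ∞ := by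
    have := hint.neg.lintegral_lt_top
    simp only [Pi.neg_apply, e2] at this; exact this.ne
  have := ENNReal.toReal_mono hf2 hcon
  linarith

lemma neg_fin (ν : Measure ℤ) [IsProbabilityMeasure ν]
    (hint : Integrable (fun x : ℤ => (x : ℝ)) ν) (hmean : 0 < ∫ x, (x : ℝ) ∂ν) :
    (∫⁻ y : ℤ, ((-y).toNat : ℝ≥0∞) ∂ν) ≠ ∞ := (pos_neg_lt ν hint hmean).ne_top

lemma GG_sum_eq (ν : Measure ℤ) [IsProbabilityMeasure ν] (n : ℕ) :
    (∑' k : ℕ, GG ν (n + 1) ((k : ℤ) + 1))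
      + ∫⁻ y, ∑ k ∈ Finset.range y.toNat, GG ν n ((k : ℤ) + 1) ∂ν
    = (∑' k : ℕ, GG ν n ((k : ℤ) + 1)) + ∫⁻ y : ℤ, ((-y).toNat : ℝ≥0∞) ∂ν := by
  have h1 : (∑' k : ℕ, GG ν (n + 1) ((k : ℤ) + 1))
      = ∫⁻ y, ∑' k : ℕ, GG ν n ((k : ℤ) + 1 + y) ∂ν := by
    rw [lintegral_tsum (fun k => (Measurable.of_discrete).aemeasurable)]
    refine tsum_congr fun k => ?_
    have hk : ¬ ((k : ℤ) + 1 ≤ 0) := by omega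
    simp only [GG, hk, if_false]
  rw [h1, ← lintegral_add_left (Measurable.of_discrete)]
  simp_rw [tsum_shift_aux (GG ν n) (GG_nonpos ν n)]
  rw [lintegral_add_left (Measurable.of_discrete)]
  simp

lemma GG_sum_fin (ν : Measure ℤ) [IsProbabilityMeasure ν]
    (hfin : (∫⁻ y : ℤ, ((-y).toNat : ℝ≥0∞) ∂ν) ≠ ∞) (n : ℕ) :
    (∑' k : ℕ, GG ν n ((k : ℤ) + 1)) ≠ ∞ := by
  induction n with
  | zero =>
    have : ∀ k : ℕ, GG ν 0 ((k : ℤ) + 1) = 0 := fun k => by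
      have hk : ¬ ((k : ℤ) + 1 ≤ 0) := by omega
      simp only [GG, hk, if_false]
    simp [this]
  | succ n ih =>
    refine ne_top_of_le_ne_top (ENNReal.add_ne_top.2 ⟨ih, hfin⟩) ?_
    rw [← GG_sum_eq]
    exact le_self_add

lemma GG_key (ν : Measure ℤ) [IsProbabilityMeasure ν]
    (hfin : (∫⁻ y : ℤ, ((-y).toNat : ℝ≥0∞) ∂ν) ≠ ∞) (n : ℕ) :
    ∫⁻ y, ∑ k ∈ Finset.range y.toNat, GG ν n ((k : ℤ) + 1) ∂ν
      ≤ ∫⁻ y : ℤ, ((-y).toNat : ℝ≥0∞) ∂ν := by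
  have h := GG_sum_eq ν n
  have h2 : (∑' k : ℕ, GG ν n ((k : ℤ) + 1)) ≤ ∑' k : ℕ, GG ν (n + 1) ((k : ℤ) + 1) :=
    ENNReal.tsum_le_tsum fun k => GG_mono ν n _
  refine (ENNReal.add_le_add_iff_left (GG_sum_fin ν hfin n)).1 ?_
  rw [← h]
  exact add_le_add_left h2 _

lemma exists_g (ν : Measure ℤ) [IsProbabilityMeasure ν]
    (hint : Integrable (fun x : ℤ => (x : ℝ)) ν) (hmean : 0 < ∫ x, (x : ℝ) ∂ν) :
    ∃ g : ℤ → ℝ≥0∞, Antitone g ∧ (∀ k, g k ≤ 1) ∧ (∀ k, ∫⁻ y, g (k + y) ∂ν ≤ g k) ∧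
      ∃ m : ℤ, g m = 1 ∧ ∫⁻ y, g (m + y) ∂ν < 1 := by
  have hfin := neg_fin ν hint hmean
  have hlt := pos_neg_lt ν hint hmean
  have hmonoN : ∀ k, Monotone fun n => GG ν n k := fun k =>
    monotone_nat_of_le_succ fun n => GG_mono ν n k
  set g : ℤ → ℝ≥0∞ := fun k => ⨆ n, GG ν n k with hg
  have hanti : Antitone g := fun a b hab => iSup_mono fun n => GG_anti ν n hab
  have hle : ∀ k, g k ≤ 1 := fun k => iSup_le fun n => GG_le_one ν n k
  have hnp : ∀ k ≤ 0, g k = 1 := fun k hk => by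
    simp only [hg, GG_nonpos ν _ k hk]; simp
  refine ⟨g, hanti, hle, ?_, ?_⟩
  · intro k
    by_cases hk : k ≤ 0
    · rw [hnp k hk]
      calc ∫⁻ y, g (k + y) ∂ν ≤ ∫⁻ y, 1 ∂ν := lintegral_mono fun y => hle _
        _ = 1 := by simp
    · simp only [hg]
      rw [lintegral_iSup (fun n => Measurable.of_discrete)
        (fun a b hab y => hmonoN (k + y) hab)]
      refine iSup_le fun n => ?_
      refine le_trans ?_ (le_iSup _ (n + 1))
      simp only [GG, hk, if_false, le_refl]
  · have hpos : ν {y : ℤ | 0 < y} ≠ 0 := by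
      intro h0
      have hae : ∀ᵐ y ∂ν, (y : ℤ) ≤ 0 := by
        rw [ae_iff]; simpa using h0
      have : ∫ x, (x : ℝ) ∂ν ≤ 0 := integral_nonpos_of_ae (by
        filter_upwards [hae] with y hy
        simpa using hy)
      linarith
    have hex : ∃ j : ℕ, g ((j : ℤ) + 1) ≠ 1 := by
      by_contra hcon
      push Not at hcon
      have h1 : ∫⁻ y : ℤ, ∑ k ∈ Finset.range y.toNat, g ((k : ℤ) + 1) ∂ν
          ≤ ∫⁻ y : ℤ, ((-y).toNat : ℝ≥0∞) ∂ν := by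
        have : ∀ y : ℤ, ∑ k ∈ Finset.range y.toNat, g ((k : ℤ) + 1)
            = ⨆ n, ∑ k ∈ Finset.range y.toNat, GG ν n ((k : ℤ) + 1) := by
          intro y
          simp only [hg]
          exact ENNReal.finsetSum_iSup_of_monotone (fun k => hmonoN _)
        simp_rw [this]
        have hmm : Monotone fun (n : ℕ) (y : ℤ) =>
            ∑ k ∈ Finset.range y.toNat, GG ν n ((k : ℤ) + 1) :=
          fun a b hab y => Finset.sum_le_sum fun k _ => hmonoN _ hab
        rw [lintegral_iSup (fun n => Measurable.of_discrete) hmm]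
        exact iSup_le fun n => GG_key ν hfin n
      simp only [hcon] at h1
      simp only [Finset.sum_const, Finset.card_range, nsmul_eq_mul, mul_one] at h1
      exact absurd h1 (not_le.2 hlt)
    classical
    refine ⟨(Nat.find hex : ℤ), ?_, ?_⟩
    · rcases Nat.eq_zero_or_pos (Nat.find hex) with h | h
      · rw [h]; exact hnp _ (by simp)
      · have := Nat.find_min hex (m := Nat.find hex - 1) (by omega)
        push Not at this
        refine Eq.trans ?_ this
        congr 1; omega
    · have hm := Nat.find_spec hex
      set m := Nat.find hex
      have := lintegral_strict_mono_of_ae_le_of_ae_lt_on (μ := ν)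
        (f := fun y => g ((m : ℤ) + y)) (g := fun _ => (1 : ℝ≥0∞)) (s := {y : ℤ | 0 < y})
        aemeasurable_const
        (ne_top_of_le_ne_top (b := ∫⁻ y, 1 ∂ν) (by simp) (lintegral_mono fun y => hle _))
        (ae_of_all _ fun y => hle _) hpos
        (ae_of_all _ fun y (hy : 0 < y) =>
          lt_of_le_of_lt (hanti (by omega)) (lt_of_le_of_ne (hle _) hm))
      simpa using this

lemma stoch_dom (ν ν' : Measure ℤ) [IsProbabilityMeasure ν] [IsProbabilityMeasure ν']
    (h : ∀ j : ℤ, ν {x | j < x} ≤ ν' {x | j < x}) (g : ℤ → ℝ≥0∞) (hg : Antitone g)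
    (hle : ∀ k, g k ≤ 1) : ∫⁻ y, g y ∂ν' ≤ ∫⁻ y, g y ∂ν := by
  have hfin : ∀ k, g k ≠ ∞ := fun k => ne_top_of_le_ne_top (by simp) (hle k)
  have e : ∀ k, g k = ENNReal.ofReal (g k).toReal := fun k => (ENNReal.ofReal_toReal (hfin k)).symm
  have hc : ∀ j : ℤ, ν' (Set.Iic j) ≤ ν (Set.Iic j) := by
    intro j
    have e1 : Set.Iic j = {x | j < x}ᶜ := by ext; simp
    rw [e1, prob_compl_eq_one_sub (.of_discrete), prob_compl_eq_one_sub (.of_discrete)]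
    exact tsub_le_tsub_left (h j) _
  rw [lintegral_congr e, lintegral_congr (μ := ν) e]
  rw [lintegral_eq_lintegral_meas_lt ν' (ae_of_all _ fun _ => ENNReal.toReal_nonneg)
      (Measurable.of_discrete).aemeasurable,
    lintegral_eq_lintegral_meas_lt ν (ae_of_all _ fun _ => ENNReal.toReal_nonneg)
      (Measurable.of_discrete).aemeasurable]
  refine lintegral_mono fun t => ?_
  set S := {a | t < (g a).toReal} with hS
  have hlow : ∀ a ∈ S, ∀ b ≤ a, b ∈ S := fun a ha b hb =>
    lt_of_lt_of_le ha (ENNReal.toReal_mono (hfin _) (hg hb))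
  by_cases hne : S.Nonempty
  · by_cases hbdd : BddAbove S
    · obtain ⟨j, hj, hj2⟩ := Int.exists_greatest_of_bdd (P := fun z => z ∈ S)
        (by obtain ⟨b, hb⟩ := hbdd; exact ⟨b, fun z hz => hb hz⟩) hne
      have : S = Set.Iic j := by
        ext z; exact ⟨fun hz => hj2 z hz, fun hz => hlow j hj z hz⟩
      change ν' S ≤ ν S
      rw [this]; exact hc j
    · have : S = Set.univ := by
        ext z
        simp only [Set.mem_univ, iff_true]
        rw [not_bddAbove_iff] at hbdd
        obtain ⟨a, ha, hza⟩ := hbdd z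
        exact hlow a ha z hza.le
      change ν' S ≤ ν S
      rw [this]; simp
  · change ν' S ≤ ν S
    rw [Set.not_nonempty_iff_eq_empty.1 hne]; simp

lemma shift_meas : Measurable (fun (ω : ℕ → ℕ) (n : ℕ) => ω (n + 1)) :=
  measurable_pi_lambda _ fun n => measurable_pi_apply _

lemma ae_start (X : MC) (i : ℕ) : ∀ᵐ ω ∂(X.μ i), ω 0 = i := by
  have := X.prob i
  have hm : MeasurableSet {ω : ℕ → ℕ | ω 0 = i} :=
    (measurable_pi_apply (X := fun _ : ℕ => ℕ) 0) (measurableSet_singleton i)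
  exact (prob_compl_eq_zero_iff hm).2 (X.start i)

lemma lint_shift (X : MC) (i : ℕ) (F : (ℕ → ℕ) → ℝ≥0∞) (hF : Measurable F) :
    ∫⁻ ω, F (fun n => ω (n + 1)) ∂(X.μ i) = ∑' j, X.P i j * ∫⁻ ω, F ω ∂(X.μ j) := by
  rw [← lintegral_map hF shift_meas, X.markov, lintegral_sum_measure]
  simp

lemma lint_one (X : MC) (i : ℕ) (f : ℕ → ℝ≥0∞) :
    ∫⁻ ω, f (ω 1) ∂(X.μ i) = ∑' j, X.P i j * f j := by
  have := lint_shift X i (fun ω => f (ω 0)) (Measurable.of_discrete.comp (measurable_pi_apply 0))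
  simp only [zero_add] at this
  rw [this]
  refine tsum_congr fun j => ?_
  congr 1
  have := X.prob j
  rw [lintegral_congr_ae (g := fun _ => f j)
    (by filter_upwards [ae_start X j] with ω h; rw [h])]
  simp

lemma step_le (X : MC) (ν : Measure ℤ) [IsProbabilityMeasure ν]
    (hmin : ∀ (i : ℕ) (j : ℤ),
      ν {x | j < x} ≤ X.μ i {ω | j < (ω 1 : ℤ) - (ω 0 : ℤ)})
    (g : ℤ → ℝ≥0∞) (hg : Antitone g) (hle : ∀ k, g k ≤ 1) (x : ℕ) (a : ℤ) :
    ∑' j, X.P x j * g ((j : ℤ) + a) ≤ ∫⁻ y, g ((x : ℤ) + a + y) ∂ν := by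
  have := X.prob x
  have hJ : Measurable (fun ω : ℕ → ℕ => (ω 1 : ℤ) - (ω 0 : ℤ)) := by fun_prop
  have hpm : IsProbabilityMeasure ((X.μ x).map (fun ω : ℕ → ℕ => (ω 1 : ℤ) - (ω 0 : ℤ))) :=
    Measure.isProbabilityMeasure_map hJ.aemeasurable
  have hdom := stoch_dom ν ((X.μ x).map (fun ω : ℕ → ℕ => (ω 1 : ℤ) - (ω 0 : ℤ)))
    (fun j => by rw [Measure.map_apply hJ (.of_discrete)]; exact hmin x j)
    (fun y => g ((x : ℤ) + a + y)) (fun u v huv => hg (by omega)) (fun k => hle _)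
  refine le_trans (le_of_eq ?_) hdom
  rw [lintegral_map (Measurable.of_discrete) hJ, ← lint_one X x (fun j => g ((j : ℤ) + a))]
  refine lintegral_congr_ae ?_
  filter_upwards [ae_start X x] with ω h
  rw [h]; congr 1; ring

lemma prod_bound (X : MC) (w u : ℕ → ℝ≥0∞) (hu : ∀ x, 1 ≤ u x)
    (hstep : ∀ x, w x * ∑' j, X.P x j * u j ≤ u x) (N : ℕ) :
    ∀ x, ∫⁻ ω, ∏ n ∈ Finset.range N, w (ω n) ∂(X.μ x) ≤ u x := by
  have hw : Measurable w := Measurable.of_discrete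
  induction N with
  | zero => intro x; have := X.prob x; simpa using hu x
  | succ N ih =>
    intro x
    have hF : Measurable fun ω : ℕ → ℕ => ∏ n ∈ Finset.range N, w (ω n) := by fun_prop
    have hF' : Measurable fun ω : ℕ → ℕ => ∏ n ∈ Finset.range N, w (ω (n + 1)) := by fun_prop
    calc ∫⁻ ω, ∏ n ∈ Finset.range (N + 1), w (ω n) ∂(X.μ x)
        = ∫⁻ ω, w x * ∏ n ∈ Finset.range N, w (ω (n + 1)) ∂(X.μ x) := by
          refine lintegral_congr_ae ?_
          filter_upwards [ae_start X x] with ω h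
          rw [Finset.prod_range_succ', h, mul_comm]
      _ = w x * ∑' j, X.P x j * ∫⁻ ω, ∏ n ∈ Finset.range N, w (ω n) ∂(X.μ j) := by
          rw [lintegral_const_mul _ hF', lint_shift X x _ hF]
      _ ≤ w x * ∑' j, X.P x j * u j := by
          gcongr with j
          exact ih j
      _ ≤ u x := hstep x

lemma tprod_eq_iSup (f : ℕ → ℝ≥0∞) (hf : ∀ n, 1 ≤ f n) :
    ∏' n, f n = ⨆ N, ∏ n ∈ Finset.range N, f n := by
  have hmono : Monotone fun s : Finset ℕ => ∏ n ∈ s, f n := fun s t hst =>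
    Finset.prod_le_prod_of_subset_of_one_le' hst fun n _ _ => hf n
  have h : HasProd f (⨆ s : Finset ℕ, ∏ n ∈ s, f n) := tendsto_atTop_iSup hmono
  have h2 : Monotone fun N : ℕ => ∏ n ∈ Finset.range N, f n := fun a b hab =>
    hmono (Finset.range_mono hab)
  rw [h.tprod_eq]
  exact tendsto_nhds_unique h.tendsto_prod_nat (tendsto_atTop_iSup h2)

theorem stmt9 (X : MC) (ν : Measure ℤ) [IsProbabilityMeasure ν]
    (hint : Integrable (fun x : ℤ => (x : ℝ)) ν)
    (hmean : 0 < ∫ x, (x : ℝ) ∂ν)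
    (hmin : ∀ (i : ℕ) (j : ℤ),
      ν {x | j < x} ≤ X.μ i {ω | j < (ω 1 : ℤ) - (ω 0 : ℤ)}) :
    ∃ γ > (0 : ℝ), (⨆ i, ∫⁻ ω, locExp γ i ω ∂(X.μ i)) < ∞ := by
  obtain ⟨g, hanti, hle, hsup, m, hm, hlt⟩ := exists_g ν hint hmean
  obtain ⟨b, hb⟩ : ∃ b, b = ∫⁻ y, g (m + y) ∂ν := ⟨_, rfl⟩
  rw [← hb] at hlt
  have hbt : b ≠ ∞ := hlt.ne_top
  have hbr : b.toReal < 1 := by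
    have := (ENNReal.toReal_lt_toReal hbt (by simp)).2 hlt
    simpa using this
  have hb0 : 0 ≤ b.toReal := ENNReal.toReal_nonneg
  have hq : 1 < 2 / (1 + b.toReal) := by rw [lt_div_iff₀ (by linarith)]; linarith
  refine ⟨Real.log (2 / (1 + b.toReal)), Real.log_pos hq, ?_⟩
  have hexp : Real.exp (Real.log (2 / (1 + b.toReal))) = 2 / (1 + b.toReal) :=
    Real.exp_log (by linarith)
  simp only [locExp, hexp]
  obtain ⟨W, hW⟩ : ∃ W, W = ENNReal.ofReal (2 / (1 + b.toReal)) := ⟨_, rfl⟩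
  rw [← hW]
  have hW1 : 1 ≤ W := by rw [hW]; simpa using hq.le
  have hWb : W * (1 + b) ≤ 2 := by
    have : 1 + b = ENNReal.ofReal (1 + b.toReal) := by
      rw [ENNReal.ofReal_add (by norm_num) hb0, ENNReal.ofReal_toReal hbt]; simp
    rw [this, hW, ← ENNReal.ofReal_mul (by positivity), div_mul_cancel₀ _ (by linarith)]
    simp
  refine lt_of_le_of_lt (b := 2) (iSup_le fun i => ?_) (by simp)
  have hf1 : ∀ (ω : ℕ → ℕ) n, 1 ≤ (if ω n = i then W else 1) := by
    intro ω n; split_ifs <;> simp [hW1]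
  simp_rw [fun ω : ℕ → ℕ => tprod_eq_iSup (fun n => if ω n = i then W else 1) (hf1 ω)]
  have hw : Measurable (fun x : ℕ => if x = i then W else 1) := Measurable.of_discrete
  have hmm : Monotone fun (N : ℕ) (ω : ℕ → ℕ) =>
      ∏ n ∈ Finset.range N, (if ω n = i then W else 1) :=
    fun a c hac ω => Finset.prod_le_prod_of_subset_of_one_le' (Finset.range_mono hac)
      fun n _ _ => hf1 ω n
  have hms : ∀ N : ℕ, Measurable fun (ω : ℕ → ℕ) =>
      ∏ n ∈ Finset.range N, (if ω n = i then W else 1) :=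
    fun N => Finset.measurable_fun_prod _ fun n _ => hw.comp (measurable_pi_apply n)
  rw [lintegral_iSup hms hmm]
  refine iSup_le fun N => ?_
  refine le_trans (prod_bound X (fun x => if x = i then W else 1)
    (fun x => 1 + g ((x : ℤ) + (m - i))) (fun x => le_self_add) ?_ N i) ?_
  · intro x
    have h1 : ∑' j, X.P x j * (1 + g ((j : ℤ) + (m - i)))
        ≤ 1 + ∫⁻ y, g ((x : ℤ) + (m - i) + y) ∂ν := by
      simp_rw [mul_add, mul_one]
      rw [ENNReal.tsum_add, X.P_sum]
      gcongr
      exact step_le X ν hmin g hanti hle x _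
    by_cases hx : x = i
    · subst hx
      have e : (x : ℤ) + (m - x) = m := by ring
      simp only [e, if_true] at h1 ⊢
      rw [← hb] at h1
      rw [hm]
      calc _ ≤ W * (1 + b) := by gcongr
        _ ≤ 2 := hWb
        _ = 1 + 1 := by norm_num
    · simp only [hx, if_false, one_mul]
      exact h1.trans (by gcongr; exact hsup _)
  · calc 1 + g ((i : ℤ) + (m - i)) ≤ 1 + 1 := by gcongr; exact hle _
      _ = 2 := by norm_num
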